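/- Under the cocoercive composite setup with its range condition and with the variable metric primal–dual iteration (exactly as in the weak-convergence result: β := min{μ, ν_1,…,ν_m}; ε ∈ (0, min{1, β}); α > 0; (λ_n) in [ε,1]; (a_n), (c_n) absolutely summable in H; (U_n) in P_α(H) nondecreasing in the Loewner order; for each i, (b_{i,n}), (d_{i,n}) absolutely summable in G_i and (U_{i,n})_n in P_α(G_i) nondecreasing in the Loewner order; R_n, S_{i,n} the positive self-adjoint square roots of U_n and U_{i,n}; δ_n := (Σ_i ‖S_{i,n} ∘ L_i ∘ R_n‖²)^{−1/2} − 1 with δ_n/((1+δ_n)·max{‖U_n‖, ‖U_{1,n}‖, …, ‖U_{m,n}‖}) ≥ 1/(2β−ε); and the updates p_n = π_n + a_n with (x_n − U_n(Σ_i L_i* v_{i,n} + C x_n + c_n − z)) − π_n ∈ {U_n u : u ∈ A π_n}, y_n = 2p_n − x_n, x_{n+1} = x_n + λ_n(p_n − x_n), and for each i, t_{i,n} with v_{i,n} ∈ D_i t_{i,n}, q_{i,n} = κ_{i,n} + b_{i,n} where for some u, κ_{i,n} ∈ B_i u and (v_{i,n} + U_{i,n}(L_i y_n − t_{i,n} −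 d_{i,n} − r_i)) − κ_{i,n} = U_{i,n} u, and v_{i,n+1} = v_{i,n} + λ_n(q_{i,n} − v_{i,n})), there exist a solution x̄ of the primal inclusion and a solution (v̄_1,…,v̄_m) of the dual inclusion with x_n ⇀ x̄ and v_{i,n} ⇀ v̄_i for every i, and moreover: if C (identified with the set-valued operator x ↦ {Cx}) is demiregular at x̄, then x_n → x̄ strongly; and if, for some j ∈ {1,…,m}, the inverse operator D_j⁻¹ : v ↦ {t : v ∈ D_j t} is demiregular at v̄_j, then v_{j,n} → v̄_j strongly. -/

import Mathlib

open RealInnerProductSpace Filter Topology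

/-- An operator `M : E → Set E` is demiregular at `x` if `M x ≠ ∅` and for every
sequence `(xs n, us n)` in the graph of `M` and every `u ∈ M x`, weak convergence
`xs n ⇀ x` together with strong convergence `us n → u` imply `xs n → x` strongly. -/
def Demiregular {E : Type*} [NormedAddCommGroup E] [InnerProductSpace ℝ E]
    (M : E → Set E) (x : E) : Prop :=
  (M x).Nonempty ∧
    ∀ xs us : ℕ → E, (∀ n, us n ∈ M (xs n)) → ∀ u ∈ M x,
      (∀ w : E, Filter.Tendsto (fun n => ⟪xs n, w⟫) Filter.atTop (nhds ⟪x, w⟫)) →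
      Filter.Tendsto us Filter.atTop (nhds u) →
      Filter.Tendsto xs Filter.atTop (nhds x)

theorem Filter.Tendsto.exists_of_le_add_summable {s w : ℕ → ℝ} (hs : ∀ n, 0 ≤ s n)
    (hw : ∀ n, 0 ≤ w n) (hsum : Summable w) (h : ∀ n, s (n + 1) ≤ s n + w n) :
    ∃ l, Tendsto s atTop (𝓝 l) := by
  have hanti : Antitone fun n => s n - ∑ k ∈ Finset.range n, w k := by
    refine antitone_nat_of_succ_le fun n => ?_
    rw [Finset.sum_range_succ]
    linarith [h n]
  have hbdd : BddBelow (Set.range fun n => s n - ∑ k ∈ Finset.range n, w k) := by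
    refine ⟨-∑' k, w k, ?_⟩
    rintro _ ⟨n, rfl⟩
    have := hsum.sum_le_tsum (Finset.range n) fun i _ => hw i
    simp only
    linarith [hs n]
  refine ⟨_, ((tendsto_atTop_ciInf hanti hbdd).add hsum.hasSum.tendsto_sum_nat).congr
    fun n => ?_⟩
  ring

section Form

variable {E : Type*} [NormedAddCommGroup E] [InnerProductSpace ℝ E] {V : E →ₗ[ℝ] E}

theorem LinearMap.IsSymmetric.inner_map_add_self (hV : V.IsSymmetric) (x y : E) :
    ⟪V (x + y), x + y⟫ = ⟪V x, x⟫ + 2 * ⟪V x, y⟫ + ⟪V y, y⟫ := by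
  have h1 : ⟪V y, x⟫ = ⟪V x, y⟫ := by rw [hV y x, real_inner_comm]
  simp only [map_add, inner_add_left, inner_add_right, h1]
  ring

theorem LinearMap.IsSymmetric.inner_map_sub_self (hV : V.IsSymmetric) (x y : E) :
    ⟪V (x - y), x - y⟫ = ⟪V x, x⟫ - 2 * ⟪V x, y⟫ + ⟪V y, y⟫ := by
  have h1 : ⟪V y, x⟫ = ⟪V x, y⟫ := by rw [hV y x, real_inner_comm]
  simp only [map_sub, inner_sub_left, inner_sub_right, h1]
  ring

theorem LinearMap.IsSymmetric.inner_map_sq_le (hV : V.IsSymmetric)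
    (hpos : ∀ x, 0 ≤ ⟪V x, x⟫) (x y : E) : ⟪V x, y⟫ ^ 2 ≤ ⟪V x, x⟫ * ⟪V y, y⟫ := by
  have h := discrim_le_zero (a := ⟪V y, y⟫) (b := 2 * ⟪V x, y⟫) (c := ⟪V x, x⟫) fun τ => by
    have := hpos (x + τ • y)
    rw [hV.inner_map_add_self] at this
    simp only [map_smul, inner_smul_left, inner_smul_right, RCLike.conj_to_real] at this
    linarith
  rw [discrim] at h
  linarith

theorem LinearMap.IsSymmetric.sqrt_inner_map_add_le (hV : V.IsSymmetric)
    (hpos : ∀ x, 0 ≤ ⟪V x, x⟫) (x y : E) :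
    √⟪V (x + y), x + y⟫ ≤ √⟪V x, x⟫ + √⟪V y, y⟫ := by
  refine Real.sqrt_le_iff.2 ⟨by positivity, ?_⟩
  have h : ⟪V x, y⟫ ≤ √⟪V x, x⟫ * √⟪V y, y⟫ := by
    rw [← Real.sqrt_mul (hpos x)]
    exact Real.le_sqrt_of_sq_le (hV.inner_map_sq_le hpos x y)
  rw [hV.inner_map_add_self, add_sq, Real.sq_sqrt (hpos x), Real.sq_sqrt (hpos y)]
  linarith

theorem LinearMap.IsSymmetric.norm_map_sq_le (hV : V.IsSymmetric)
    (hpos : ∀ x, 0 ≤ ⟪V x, x⟫) {K : ℝ} (hK : ∀ x, ⟪V x, x⟫ ≤ K * ‖x‖ ^ 2) (x : E) :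
    ‖V x‖ ^ 2 ≤ K * ⟪V x, x⟫ := by
  rcases eq_or_ne (V x) 0 with h0 | h0
  · simp [h0]
  have h := hV.inner_map_sq_le hpos x (V x)
  rw [real_inner_self_eq_norm_sq] at h
  have h2 := mul_le_mul_of_nonneg_left (hK (V x)) (hpos x)
  have hp : 0 < ‖V x‖ ^ 2 := by positivity
  nlinarith

theorem LinearMap.IsSymmetric.inner_map_convex_le (hV : V.IsSymmetric)
    (hpos : ∀ x, 0 ≤ ⟪V x, x⟫) {τ : ℝ} (h0 : 0 ≤ τ) (h1 : τ ≤ 1) (x y : E) :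
    ⟪V (x + τ • (y - x)), x + τ • (y - x)⟫ ≤ (1 - τ) * ⟪V x, x⟫ + τ * ⟪V y, y⟫ := by
  have h := hpos (y - x)
  have h2 : ⟪V x, y - x⟫ = ⟪V x, y⟫ - ⟪V x, x⟫ := inner_sub_right ..
  have h3 : ⟪V y, x⟫ = ⟪V x, y⟫ := by rw [hV y x, real_inner_comm]
  have h4 := hV.inner_map_sub_self y x
  rw [hV.inner_map_add_self]
  simp only [map_smul, inner_smul_left, inner_smul_right, RCLike.conj_to_real, h2]
  nlinarith [mul_nonneg (mul_nonneg h0 (sub_nonneg.2 h1)) h]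

theorem forward_backward_step_le {θ β : ℝ} (hβ : 0 < β) (hθ : 0 < θ)
    (hθβ : 1 < 2 * β * θ) (hV : V.IsSymmetric) (hVθ : ∀ x, θ * ‖x‖ ^ 2 ≤ ⟪V x, x⟫)
    {ζ ρ e g ζ' g' : E} (hmono : 0 ≤ ⟪ρ - ζ', V (ζ - ρ) + e - (g - g')⟫)
    (hcoco : β * ‖g - g'‖ ^ 2 ≤ ⟪ζ - ζ', g - g'⟫) :
    ⟪V (ρ - ζ'), ρ - ζ'⟫ + (2 * β * θ - 1) / (θ + 2 * β) * (‖ζ - ρ‖ ^ 2 + ‖g - g'‖ ^ 2) ≤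
      ⟪V (ζ - ζ'), ζ - ζ'⟫ + 2 * (‖ρ - ζ'‖ * ‖e‖) := by
  set σ := (2 * β * θ - 1) / (θ + 2 * β) with hσ
  have hσ0 : 0 < σ := div_pos (by linarith) (by linarith)
  have hσe : σ * (θ + 2 * β) = 2 * β * θ - 1 := div_mul_cancel₀ _ (by positivity)
  have hσθ : 0 < θ - σ := by nlinarith
  have e1 : ζ - ζ' = (ρ - ζ') + (ζ - ρ) := by abel
  have h1 := hV.inner_map_add_self (ρ - ζ') (ζ - ρ)
  rw [← e1] at h1
  have h2 : ⟪ρ - ζ', V (ζ - ρ)⟫ = ⟪V (ρ - ζ'), ζ - ρ⟫ := (hV _ _).symm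
  have h3 : ⟪ζ - ζ', g - g'⟫ = ⟪ρ - ζ', g - g'⟫ + ⟪ζ - ρ, g - g'⟫ := by
    rw [e1, inner_add_left]
  have h4 := real_inner_le_norm (ζ - ρ) (g - g')
  have h5 := real_inner_le_norm (ρ - ζ') e
  rw [inner_sub_right, inner_add_right] at hmono
  have h6 := hVθ (ζ - ρ)
  have key : 0 ≤ (θ - σ) * ‖ζ - ρ‖ ^ 2 - 2 * (‖ζ - ρ‖ * ‖g - g'‖) +
      (2 * β - σ) * ‖g - g'‖ ^ 2 := by
    refine nonneg_of_mul_nonneg_right (a := θ - σ) ?_ hσθ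
    have : (θ - σ) * (2 * β - σ) = 1 + σ ^ 2 := by linear_combination -hσe
    have : (θ - σ) * ((θ - σ) * ‖ζ - ρ‖ ^ 2 - 2 * (‖ζ - ρ‖ * ‖g - g'‖) +
      (2 * β - σ) * ‖g - g'‖ ^ 2) = ((θ - σ) * ‖ζ - ρ‖ - ‖g - g'‖) ^ 2 +
        σ ^ 2 * ‖g - g'‖ ^ 2 := by linear_combination ‖g - g'‖ ^ 2 * this
    rw [this]
    positivity
  linarith

end Form

section Weak

variable {E : Type*} [NormedAddCommGroup E] [InnerProductSpace ℝ E]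

theorem exists_weak_limit_of_norm_le [CompleteSpace E] {x : ℕ → E} {M : ℝ}
    (hM : ∀ n, ‖x n‖ ≤ M) (l : Ultrafilter ℕ) :
    ∃ xb : E, ∀ w, Tendsto (fun n => ⟪x n, w⟫) l (𝓝 ⟪xb, w⟫) := by
  let f : ℕ → WeakDual ℝ E := fun n => StrongDual.toWeakDual (InnerProductSpace.toDual ℝ E (x n))
  have hc := WeakDual.isCompact_closedBall (𝕜 := ℝ) (E := E) 0 M
  obtain ⟨φ, -, hφ⟩ := hc.ultrafilter_le_nhds (l.map f) (by
    rw [le_principal_iff]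
    refine Ultrafilter.mem_map.2 (Filter.univ_mem' fun n => ?_)
    change InnerProductSpace.toDual ℝ E (x n) ∈ Metric.closedBall 0 M
    simpa using hM n)
  refine ⟨(InnerProductSpace.toDual ℝ E).symm (WeakDual.toStrongDual φ), fun w => ?_⟩
  have : Tendsto (fun n => f n w) l (𝓝 (φ w)) :=
    ((WeakDual.eval_continuous w).tendsto φ).comp hφ
  simpa [f] using this

theorem tendsto_inner_of_weak_of_strong {ι : Type*} {l : Filter ι} {x h : ι → E} {xb hb : E}
    {M : ℝ} (hM : ∀ n, ‖x n‖ ≤ M) (hx : ∀ w, Tendsto (fun n => ⟪x n, w⟫) l (𝓝 ⟪xb, w⟫))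
    (hh : Tendsto h l (𝓝 hb)) : Tendsto (fun n => ⟪x n, h n⟫) l (𝓝 ⟪xb, hb⟫) := by
  have h0 : Tendsto (fun n => ⟪x n, h n - hb⟫) l (𝓝 0) := by
    refine squeeze_zero_norm (a := fun n => M * ‖h n - hb‖) (fun n => ?_) ?_
    · exact (norm_inner_le_norm _ _).trans (by gcongr; exact hM n)
    · simpa using ((tendsto_iff_norm_sub_tendsto_zero.1 hh).const_mul M)
  refine (by simpa using (hx hb).add h0 : Tendsto _ l (𝓝 ⟪xb, hb⟫)).congr fun n => ?_
  rw [inner_sub_right]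
  ring

/-- The graph of a maximally monotone operator is closed for the weak times strong topology
along bounded families. -/
theorem mem_of_tendsto_weak_strong {ι : Type*} {l : Filter ι} [l.NeBot] {M : E → Set E}
    (hmono : ∀ x y u v : E, u ∈ M x → v ∈ M y → ⟪x - y, u - v⟫ ≥ 0)
    (hmax : ∀ y v : E, (∀ x u : E, u ∈ M x → ⟪x - y, u - v⟫ ≥ 0) → v ∈ M y)
    {x u : ι → E} {xb ub : E} {K : ℝ} (hmem : ∀ n, u n ∈ M (x n)) (hK : ∀ n, ‖x n‖ ≤ K)
    (hx : ∀ w, Tendsto (fun n => ⟪x n, w⟫) l (𝓝 ⟪xb, w⟫)) (hu : Tendsto u l (𝓝 ub)) :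
    ub ∈ M xb := by
  refine hmax xb ub fun y v hv => ?_
  have h1 : Tendsto (fun n => ⟪y, v - u n⟫ - ⟪x n, v - u n⟫) l
      (𝓝 (⟪y, v - ub⟫ - ⟪xb, v - ub⟫)) :=
    (tendsto_const_nhds.inner (hu.const_sub v)).sub
      (tendsto_inner_of_weak_of_strong hK hx (hu.const_sub v))
  rw [← inner_sub_left] at h1
  refine ge_of_tendsto' h1 fun n => ?_
  rw [← inner_sub_left]
  exact hmono _ _ _ _ hv (hmem n)

end Weak

section ForwardBackward

variable {E : Type*} [NormedAddCommGroup E] [InnerProductSpace ℝ E]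

/-- Quasi-Fejér property of a relaxed variable metric forward-backward iteration with summable
errors. -/
theorem forward_backward_quasi_fejer {θ β ε K : ℝ} (hβ : 0 < β) (hθ : 0 < θ)
    (hθβ : 1 < 2 * β * θ) (hε : 0 < ε) {V : ℕ → E →ₗ[ℝ] E} (hV : ∀ n, (V n).IsSymmetric)
    (hVθ : ∀ n x, θ * ‖x‖ ^ 2 ≤ ⟪V n x, x⟫)
    (hVanti : ∀ n x, ⟪V (n + 1) x, x⟫ ≤ ⟪V n x, x⟫)
    (hVK : ∀ n x, ⟪V n x, x⟫ ≤ K * ‖x‖ ^ 2) {τ : ℕ → ℝ} (hτ : ∀ n, τ n ∈ Set.Icc ε 1)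
    {ζ ρ e f g : ℕ → E} {ζ' g' : E}
    (he : Summable fun n => ‖e n‖) (hf : Summable fun n => ‖f n‖)
    (hrec : ∀ n, ζ (n + 1) = ζ n + τ n • (ρ n + f n - ζ n))
    (hmono : ∀ n, 0 ≤ ⟪ρ n - ζ', V n (ζ n - ρ n) + e n - (g n - g')⟫)
    (hcoco : ∀ n, β * ‖g n - g'‖ ^ 2 ≤ ⟪ζ n - ζ', g n - g'⟫) :
    (∃ l, Tendsto (fun n => ⟪V n (ζ n - ζ'), ζ n - ζ'⟫) atTop (𝓝 l)) ∧
      (∃ M, ∀ n, ‖ζ n‖ ≤ M) ∧ Tendsto (fun n => ζ n - ρ n) atTop (𝓝 0) ∧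
      Tendsto g atTop (𝓝 g') := by
  have hpos : ∀ n x, 0 ≤ ⟪V n x, x⟫ := fun n x => le_trans (by positivity) (hVθ n x)
  have hnorm : ∀ n x, √θ * ‖x‖ ≤ √⟪V n x, x⟫ := fun n x => by
    rw [← Real.sqrt_sq (norm_nonneg x), ← Real.sqrt_mul hθ.le]
    exact Real.sqrt_le_sqrt (hVθ n x)
  have hθs : 0 < √θ := Real.sqrt_pos.2 hθ
  set σ := (2 * β * θ - 1) / (θ + 2 * β) with hσ
  have hσ0 : 0 < σ := div_pos (by linarith) (by linarith)
  set s : ℕ → ℝ := fun n => √⟪V n (ζ n - ζ'), ζ n - ζ'⟫ with hs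
  set q : ℕ → ℝ := fun n => √⟪V n (ρ n - ζ'), ρ n - ζ'⟫ with hq
  set X : ℕ → ℝ := fun n => ‖e n‖ / √θ with hX
  set F : ℕ → ℝ := fun n => √K * ‖f n‖ with hF
  have hs0 : ∀ n, 0 ≤ s n := fun n => Real.sqrt_nonneg _
  have hq0 : ∀ n, 0 ≤ q n := fun n => Real.sqrt_nonneg _
  have hX0 : ∀ n, 0 ≤ X n := fun n => by positivity
  have hF0 : ∀ n, 0 ≤ F n := fun n => by positivity
  have hs2 : ∀ n, s n ^ 2 = ⟪V n (ζ n - ζ'), ζ n - ζ'⟫ := fun n => Real.sq_sqrt (hpos _ _)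
  have hq2 : ∀ n, q n ^ 2 = ⟪V n (ρ n - ζ'), ρ n - ζ'⟫ := fun n => Real.sq_sqrt (hpos _ _)
  have hFle : ∀ n, √⟪V n (f n), f n⟫ ≤ F n := fun n => by
    refine (Real.sqrt_le_sqrt (hVK n (f n))).trans_eq ?_
    rw [Real.sqrt_mul' _ (by positivity), Real.sqrt_sq (norm_nonneg _)]
  have hqs : ∀ n, q n ^ 2 + σ * (‖ζ n - ρ n‖ ^ 2 + ‖g n - g'‖ ^ 2) ≤
      s n ^ 2 + 2 * (q n * X n) := fun n => by
    have h1 := forward_backward_step_le hβ hθ hθβ (hV n) (hVθ n) (hmono n) (hcoco n)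
    have h2 : ‖ρ n - ζ'‖ * ‖e n‖ ≤ q n * X n := by
      have h3 : ‖ρ n - ζ'‖ * ‖e n‖ = (√θ * ‖ρ n - ζ'‖) * X n := by
        simp only [hX]; field_simp
      rw [h3]
      exact mul_le_mul_of_nonneg_right (hnorm n _) (hX0 n)
    rw [hs2, hq2]
    linarith
  have hqle : ∀ n, q n ≤ s n + 2 * X n := fun n => by
    have h1 := hqs n
    have h2 : 0 ≤ σ * (‖ζ n - ρ n‖ ^ 2 + ‖g n - g'‖ ^ 2) := by positivity
    have h3 : (q n - X n) ^ 2 ≤ (s n + X n) ^ 2 := by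
      nlinarith [mul_nonneg (hs0 n) (hX0 n)]
    have := (abs_le.1 (abs_le_of_sq_le_sq h3 (add_nonneg (hs0 n) (hX0 n)))).2
    linarith
  have hstep : ∀ n, s (n + 1) ^ 2 ≤ (1 - τ n) * s n ^ 2 + τ n * (q n + F n) ^ 2 := fun n => by
    have h1 := (hV n).inner_map_convex_le (hpos n) (hε.le.trans (hτ n).1) (hτ n).2
      (ζ n - ζ') (ρ n - ζ' + f n)
    have h2 : ζ n - ζ' + τ n • (ρ n - ζ' + f n - (ζ n - ζ')) = ζ (n + 1) - ζ' := by
      rw [hrec, show ρ n - ζ' + f n - (ζ n - ζ') = ρ n + f n - ζ n by abel]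
      abel
    rw [h2] at h1
    have h3 := (hV n).sqrt_inner_map_add_le (hpos n) (ρ n - ζ') (f n)
    have h4 := (Real.sqrt_le_left (by positivity [hq0 n, hF0 n])).1
      (h3.trans (add_le_add_right (hFle n) (q n)))
    rw [hs2, hs2]
    have h5 := hVanti n (ζ (n + 1) - ζ')
    have h6 := mul_le_mul_of_nonneg_left h4 (hε.le.trans (hτ n).1)
    linarith
  have hsle : ∀ n, s (n + 1) ≤ s n + (2 * X n + F n) := fun n => by
    refine le_of_sq_le_sq ?_ (by linarith [hs0 n, hX0 n, hF0 n])
    refine (hstep n).trans ?_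
    have h1 : (q n + F n) ^ 2 ≤ (s n + (2 * X n + F n)) ^ 2 :=
      pow_le_pow_left₀ (add_nonneg (hq0 n) (hF0 n)) (by linarith [hqle n]) 2
    have h2 : s n ^ 2 ≤ (s n + (2 * X n + F n)) ^ 2 :=
      pow_le_pow_left₀ (hs0 n) (by linarith [hX0 n, hF0 n]) 2
    have := mul_le_mul_of_nonneg_left h1 (hε.le.trans (hτ n).1)
    have := mul_le_mul_of_nonneg_left h2 (sub_nonneg.2 (hτ n).2)
    linarith
  have hXs : Summable X := he.div_const _
  have hFs : Summable F := hf.mul_left _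
  obtain ⟨l, hl⟩ := Filter.Tendsto.exists_of_le_add_summable hs0
    (fun n => by linarith [hX0 n, hF0 n]) ((hXs.mul_left 2).add hFs) hsle
  obtain ⟨M, hM⟩ := hl.bddAbove_range
  have hbound : ∀ n, ‖ζ n‖ ≤ M / √θ + ‖ζ'‖ := fun n => by
    have h1 : ‖ζ n - ζ'‖ ≤ M / √θ := by
      rw [le_div_iff₀ hθs, mul_comm]
      exact (hnorm n _).trans (hM ⟨n, rfl⟩)
    have h2 := norm_add_le (ζ n - ζ') ζ'
    rw [sub_add_cancel] at h2
    linarith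
  have hdiff : Tendsto (fun n => ‖ζ n - ρ n‖ ^ 2 + ‖g n - g'‖ ^ 2) atTop (𝓝 0) := by
    have hX' := hXs.tendsto_atTop_zero
    have hF' := hFs.tendsto_atTop_zero
    have hq' : Tendsto (fun n => s n + 2 * X n) atTop (𝓝 l) := by
      simpa using hl.add (hX'.const_mul 2)
    have hlim : Tendsto (fun n => (s n ^ 2 - s (n + 1) ^ 2 + 2 * ((s n + 2 * X n) * X n) +
        2 * ((s n + 2 * X n) * F n) + F n ^ 2) / (ε * σ)) atTop (𝓝 0) := by
      simpa using (((((hl.pow 2).sub (((tendsto_add_atTop_iff_nat 1).2 hl).pow 2)).add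
        ((hq'.mul hX').const_mul 2)).add ((hq'.mul hF').const_mul 2)).add
        (hF'.pow 2)).div_const (ε * σ)
    refine squeeze_zero (fun n => by positivity) (fun n => ?_) hlim
    rw [le_div_iff₀ (by positivity)]
    obtain ⟨h1, h2⟩ := hτ n
    have h0 : 0 ≤ ‖ζ n - ρ n‖ ^ 2 + ‖g n - g'‖ ^ 2 := by positivity
    have h3 := mul_le_mul_of_nonneg_left (hqs n) (hε.le.trans h1)
    have h4 := hstep n
    have h5 := mul_le_mul_of_nonneg_right (hqle n) (hX0 n)
    have h6 := mul_le_mul_of_nonneg_right (hqle n) (hF0 n)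
    have h7 := mul_le_mul_of_nonneg_right h1 (mul_nonneg hσ0.le h0)
    have h8 : τ n * (2 * (q n * X n) + 2 * (q n * F n) + F n ^ 2) ≤
        1 * (2 * (q n * X n) + 2 * (q n * F n) + F n ^ 2) :=
      mul_le_mul_of_nonneg_right h2 (by
        have := mul_nonneg (hq0 n) (hX0 n)
        have := mul_nonneg (hq0 n) (hF0 n)
        positivity)
    linarith
  have hzero : ∀ {u : ℕ → E}, (∀ n, ‖u n‖ ^ 2 ≤ ‖ζ n - ρ n‖ ^ 2 + ‖g n - g'‖ ^ 2) →
      Tendsto u atTop (𝓝 0) := fun {u} hu => by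
    have h1 := (squeeze_zero (fun n => sq_nonneg ‖u n‖) hu hdiff).sqrt
    rw [Real.sqrt_zero] at h1
    exact tendsto_zero_iff_norm_tendsto_zero.2
      (h1.congr fun n => Real.sqrt_sq (norm_nonneg _))
  refine ⟨⟨l ^ 2, (hl.pow 2).congr hs2⟩, ⟨_, hbound⟩, hzero fun n => ?_, ?_⟩
  · exact le_add_of_nonneg_right (sq_nonneg _)
  · exact tendsto_sub_nhds_zero_iff.1 (hzero fun n => le_add_of_nonneg_left (sq_nonneg _))

/-- A decreasing sequence of symmetric positive operators converges pointwise. -/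
theorem exists_tendsto_of_antitone_symmetric [CompleteSpace E] {K : ℝ} {V : ℕ → E →ₗ[ℝ] E}
    (hV : ∀ n, (V n).IsSymmetric) (hpos : ∀ n x, 0 ≤ ⟪V n x, x⟫)
    (hVanti : ∀ n x, ⟪V (n + 1) x, x⟫ ≤ ⟪V n x, x⟫)
    (hVK : ∀ n x, ⟪V n x, x⟫ ≤ K * ‖x‖ ^ 2) (x : E) :
    ∃ w, Tendsto (fun n => V n x) atTop (𝓝 w) := by
  have hanti : ∀ x, Antitone fun n => ⟪V n x, x⟫ := fun x =>
    antitone_nat_of_succ_le fun n => hVanti n x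
  have hcauchy : CauchySeq fun n => ⟪V n x, x⟫ :=
    (tendsto_atTop_ciInf (hanti x) ⟨0, by rintro _ ⟨n, rfl⟩; exact hpos n x⟩).cauchySeq
  have hle : ∀ N n, N ≤ n → ‖V N x - V n x‖ ^ 2 ≤ K * (⟪V N x, x⟫ - ⟪V n x, x⟫) := by
    intro N n hNn
    have h := ((hV N).sub (hV n)).norm_map_sq_le (K := K)
      (fun y => by simpa [inner_sub_left] using hanti y hNn)
      (fun y => by
        have := hVK N y
        have := hpos n y
        simp only [LinearMap.sub_apply, inner_sub_left]
        linarith) x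
    simpa [inner_sub_left] using h
  refine cauchySeq_tendsto_of_complete (Metric.cauchySeq_iff'.2 fun η hη => ?_)
  obtain ⟨N, hN⟩ := Metric.cauchySeq_iff'.1 hcauchy (η ^ 2 / (|K| + 1)) (by positivity)
  refine ⟨N, fun n hn => ?_⟩
  have h1 := hN n hn
  rw [dist_comm, Real.dist_eq, lt_div_iff₀ (by positivity)] at h1
  rw [dist_comm, dist_eq_norm]
  refine lt_of_pow_lt_pow_left₀ 2 hη.le ((hle N n hn).trans_lt (lt_of_le_of_lt ?_ h1))
  have h3 := abs_nonneg (⟪V N x, x⟫ - ⟪V n x, x⟫)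
  have h4 := le_abs_self (K * (⟪V N x, x⟫ - ⟪V n x, x⟫))
  rw [abs_mul] at h4
  linarith

/-- Opial's argument in a decreasing variable metric: two weak limits along ultrafilters of a
sequence whose variable metric distances to both of them converge are equal. -/
theorem eq_of_weak_limits_of_variable_metric [CompleteSpace E] {θ K M : ℝ} (hθ : 0 < θ)
    {V : ℕ → E →ₗ[ℝ] E} (hV : ∀ n, (V n).IsSymmetric)
    (hVθ : ∀ n x, θ * ‖x‖ ^ 2 ≤ ⟪V n x, x⟫)
    (hVanti : ∀ n x, ⟪V (n + 1) x, x⟫ ≤ ⟪V n x, x⟫)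
    (hVK : ∀ n x, ⟪V n x, x⟫ ≤ K * ‖x‖ ^ 2) {ζ : ℕ → E} (hM : ∀ n, ‖ζ n‖ ≤ M)
    {x y : E} (hx : ∃ l, Tendsto (fun n => ⟪V n (ζ n - x), ζ n - x⟫) atTop (𝓝 l))
    (hy : ∃ l, Tendsto (fun n => ⟪V n (ζ n - y), ζ n - y⟫) atTop (𝓝 l))
    {l₁ l₂ : Filter ℕ} [l₁.NeBot] [l₂.NeBot] (h₁ : l₁ ≤ atTop) (h₂ : l₂ ≤ atTop)
    (hwx : ∀ w, Tendsto (fun n => ⟪ζ n, w⟫) l₁ (𝓝 ⟪x, w⟫))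
    (hwy : ∀ w, Tendsto (fun n => ⟪ζ n, w⟫) l₂ (𝓝 ⟪y, w⟫)) : x = y := by
  have hpos : ∀ n x, 0 ≤ ⟪V n x, x⟫ := fun n x => le_trans (by positivity) (hVθ n x)
  have hlim := exists_tendsto_of_antitone_symmetric hV hpos hVanti hVK
  obtain ⟨a, ha⟩ := hx
  obtain ⟨b, hb⟩ := hy
  obtain ⟨kx, hkx⟩ := hlim x
  obtain ⟨ky, hky⟩ := hlim y
  obtain ⟨k, hk⟩ := hlim (x - y)
  have hc := (((ha.sub hb).sub (hkx.inner (tendsto_const_nhds (x := x)))).add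
    (hky.inner (tendsto_const_nhds (x := y)))).div_const (-2)
  have hc' := hc.congr (f₂ := fun n => ⟪ζ n, V n (x - y)⟫) fun n => by
    rw [(hV n).inner_map_sub_self, (hV n).inner_map_sub_self, hV n (ζ n) x,
      hV n (ζ n) y, map_sub, inner_sub_right]
    ring
  have e1 := tendsto_nhds_unique (hc'.mono_left h₁)
    (tendsto_inner_of_weak_of_strong hM hwx (hk.mono_left h₁))
  have e2 := tendsto_nhds_unique (hc'.mono_left h₂)
    (tendsto_inner_of_weak_of_strong hM hwy (hk.mono_left h₂))
  have e3 : ⟪k, x - y⟫ = 0 := by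
    rw [real_inner_comm, inner_sub_left, ← e1, ← e2, sub_self]
  have e4 : θ * ‖x - y‖ ^ 2 ≤ 0 := by
    rw [← e3]
    exact ge_of_tendsto' (hk.inner tendsto_const_nhds) fun n => hVθ n _
  have e5 : ‖x - y‖ ^ 2 ≤ 0 := nonpos_of_mul_nonpos_right e4 hθ
  exact sub_eq_zero.1 (norm_eq_zero.1 (pow_eq_zero_iff two_ne_zero |>.1
    (le_antisymm e5 (sq_nonneg _))))

/-- Weak convergence of the relaxed variable metric forward-backward iteration with summable
errors, together with strong convergence of the images under the cocoercive operator. -/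
theorem forward_backward_weak_convergence [CompleteSpace E] {θ β ε : ℝ} (hβ : 0 < β)
    (hθ : 0 < θ) (hθβ : 1 < 2 * β * θ) (hε : 0 < ε) {M N : E → Set E}
    (hMmono : ∀ x y u v : E, u ∈ M x → v ∈ M y → ⟪x - y, u - v⟫ ≥ 0)
    (hMmax : ∀ y v : E, (∀ x u : E, u ∈ M x → ⟪x - y, u - v⟫ ≥ 0) → v ∈ M y)
    (hNcoco : ∀ x y u v : E, u ∈ N x → v ∈ N y → ⟪x - y, u - v⟫ ≥ β * ‖u - v‖ ^ 2)
    (hNmax : ∀ y v : E, (∀ x u : E, u ∈ N x → ⟪x - y, u - v⟫ ≥ 0) → v ∈ N y)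
    (hzer : ∃ x u, u ∈ N x ∧ -u ∈ M x)
    {V : ℕ → E →ₗ[ℝ] E} (hV : ∀ n, (V n).IsSymmetric)
    (hVθ : ∀ n x, θ * ‖x‖ ^ 2 ≤ ⟪V n x, x⟫)
    (hVanti : ∀ n x, ⟪V (n + 1) x, x⟫ ≤ ⟪V n x, x⟫)
    {τ : ℕ → ℝ} (hτ : ∀ n, τ n ∈ Set.Icc ε 1) {ζ ρ e f g : ℕ → E}
    (he : Summable fun n => ‖e n‖) (hf : Summable fun n => ‖f n‖)
    (hrec : ∀ n, ζ (n + 1) = ζ n + τ n • (ρ n + f n - ζ n))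
    (hg : ∀ n, g n ∈ N (ζ n)) (hρ : ∀ n, V n (ζ n - ρ n) + e n - g n ∈ M (ρ n)) :
    ∃ x u, u ∈ N x ∧ -u ∈ M x ∧ (∀ w, Tendsto (fun n => ⟪ζ n, w⟫) atTop (𝓝 ⟪x, w⟫)) ∧
      Tendsto g atTop (𝓝 u) := by
  have hpos : ∀ n x, 0 ≤ ⟪V n x, x⟫ := fun n x => le_trans (by positivity) (hVθ n x)
  obtain ⟨K, hK⟩ : ∃ K, ∀ n x, ⟪V n x, x⟫ ≤ K * ‖x‖ ^ 2 := by
    let W : E →L[ℝ] E := ⟨V 0, (hV 0).continuous⟩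
    refine ⟨‖W‖, fun n x => ?_⟩
    have h1 : ⟪V n x, x⟫ ≤ ⟪V 0 x, x⟫ :=
      antitone_nat_of_succ_le (f := fun n => ⟪V n x, x⟫) (fun n => hVanti n x) (Nat.zero_le n)
    have h2 : ⟪W x, x⟫ ≤ ‖W x‖ * ‖x‖ := real_inner_le_norm _ _
    have h3 := mul_le_mul_of_nonneg_right (W.le_opNorm x) (norm_nonneg x)
    change ⟪V 0 x, x⟫ ≤ _ at h2
    linarith
  have hfejer : ∀ x u, u ∈ N x → -u ∈ M x → _ := fun x u hu hu' =>
    forward_backward_quasi_fejer (ζ' := x) (g' := u) hβ hθ hθβ hε hV hVθ hVanti hK hτ he hf hrec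
      (fun n => by
        have := hMmono _ _ _ _ (hρ n) hu'
        rwa [sub_neg_eq_add, sub_add] at this)
      (fun n => hNcoco _ _ _ _ (hg n) hu)
  obtain ⟨x₀, u₀, hu₀, hu₀'⟩ := hzer
  obtain ⟨-, ⟨B, hB⟩, hζρ, hgu⟩ := hfejer x₀ u₀ hu₀ hu₀'
  have hVζρ : Tendsto (fun n => V n (ζ n - ρ n)) atTop (𝓝 0) := by
    refine squeeze_zero_norm (a := fun n => |K| * ‖ζ n - ρ n‖) (fun n => ?_) (by
      simpa using hζρ.norm.const_mul |K|)
    refine le_of_sq_le_sq ?_ (by positivity)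
    have h1 := (hV n).norm_map_sq_le (hpos n) (hK n) (ζ n - ρ n)
    have h2 := mul_le_mul (le_abs_self K) ((hK n (ζ n - ρ n)).trans
      (mul_le_mul_of_nonneg_right (le_abs_self K) (sq_nonneg _))) (hpos n _) (abs_nonneg K)
    linarith
  have hlimM : Tendsto (fun n => V n (ζ n - ρ n) + e n - g n) atTop (𝓝 (-u₀)) := by
    simpa using (hVζρ.add (tendsto_zero_iff_norm_tendsto_zero.2 he.tendsto_atTop_zero)).sub hgu
  obtain ⟨B', hB'⟩ := hζρ.norm.bddAbove_range
  have hρB : ∀ n, ‖ρ n‖ ≤ B + B' := fun n => by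
    have h1 := norm_sub_le (ζ n) (ζ n - ρ n)
    rw [sub_sub_cancel] at h1
    have h2 : ‖ζ n - ρ n‖ ≤ B' := hB' ⟨n, rfl⟩
    linarith [hB n]
  have hcluster : ∀ l : Ultrafilter ℕ, (l : Filter ℕ) ≤ atTop →
      ∃ x, u₀ ∈ N x ∧ -u₀ ∈ M x ∧ ∀ w, Tendsto (fun n => ⟪ζ n, w⟫) l (𝓝 ⟪x, w⟫) := by
    intro l hl
    obtain ⟨x, hx⟩ := exists_weak_limit_of_norm_le hB l
    refine ⟨x, ?_, ?_, hx⟩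
    · exact mem_of_tendsto_weak_strong (fun _ _ _ _ h h' =>
        le_trans (by positivity) (hNcoco _ _ _ _ h h')) hNmax hg hB hx (hgu.mono_left hl)
    · refine mem_of_tendsto_weak_strong hMmono hMmax hρ hρB (fun w => ?_)
        (hlimM.mono_left hl)
      have h1 := (hx w).sub ((hζρ.mono_left hl).inner (tendsto_const_nhds (x := w)))
      simpa [inner_sub_left] using h1
  obtain ⟨x, hx, hx', hxw⟩ := hcluster (Ultrafilter.of atTop) (Ultrafilter.of_le _)
  refine ⟨x, u₀, hx, hx', fun w => ?_, hgu⟩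
  rw [tendsto_iff_ultrafilter]
  intro l hl
  obtain ⟨y, hy, hy', hyw⟩ := hcluster l hl
  have : x = y := eq_of_weak_limits_of_variable_metric hθ hV hVθ hVanti hK hB
    (hfejer x u₀ hx hx').1 (hfejer y u₀ hy hy').1 (Ultrafilter.of_le _) hl hxw hyw
  exact this ▸ hyw w

end ForwardBackward

section Inverse

variable {E : Type*} [NormedAddCommGroup E] [InnerProductSpace ℝ E]

theorem ContinuousLinearMap.exists_inverse_of_coercive [CompleteSpace E] {U : E →L[ℝ] E} {α : ℝ}
    (hα : 0 < α) (hU : ∀ x, ⟪U x, x⟫ ≥ α * ‖x‖ ^ 2) :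
    ∃ T : E →L[ℝ] E, (∀ x, U (T x) = x) ∧ ∀ x, T (U x) = x := by
  obtain ⟨T, hUT, hTU⟩ := isUnit_iff_exists.1
    (ContinuousLinearMap.isUnit_of_forall_le_norm_inner_map U (c := ⟨α, hα.le⟩) hα fun x => by
      rw [mul_comm]
      exact (hU x).trans (le_abs_self _))
  exact ⟨T, fun x => DFunLike.congr_fun hUT x, fun x => DFunLike.congr_fun hTU x⟩

theorem inner_right_inverse_comm {U T : E →L[ℝ] E} (hU : ∀ x y, ⟪U x, y⟫ = ⟪x, U y⟫)
    (hUT : ∀ x, U (T x) = x) (x y : E) : ⟪T x, y⟫ = ⟪x, T y⟫ := by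
  conv_lhs => rw [← hUT y, ← hU, hUT]

theorem inner_right_inverse_anti {U U' T T' : E →L[ℝ] E} (hU : ∀ x y, ⟪U x, y⟫ = ⟪x, U y⟫)
    (hpos : ∀ x, 0 ≤ ⟪U x, x⟫) (hle : ∀ x, ⟪U x, x⟫ ≤ ⟪U' x, x⟫)
    (hUT : ∀ x, U (T x) = x) (hUT' : ∀ x, U' (T' x) = x) (x : E) : ⟪T' x, x⟫ ≤ ⟪T x, x⟫ := by
  have h1 := hpos (T x - T' x)
  have h2 := hle (T' x)
  have h3 : ⟪U (T' x), T x⟫ = ⟪T' x, x⟫ := by rw [hU, hUT]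
  have h4 : ⟪x, T x⟫ = ⟪T x, x⟫ := real_inner_comm _ _
  have h5 : ⟪x, T' x⟫ = ⟪T' x, x⟫ := real_inner_comm _ _
  rw [hUT', h5] at h2
  rw [map_sub, inner_sub_left, inner_sub_right, inner_sub_right, hUT, h3, h4, h5] at h1
  linarith

theorem exists_inner_nonpos_of_maximal {M : E → Set E}
    (hM : ∀ y v : E, (∀ x u : E, u ∈ M x → ⟪x - y, u - v⟫ ≥ 0) → v ∈ M y) (y v : E) :
    ∃ x u, u ∈ M x ∧ ⟪x - y, u - v⟫ ≤ 0 ∧ (v ∉ M y → ⟪x - y, u - v⟫ < 0) := by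
  by_cases hv : v ∈ M y
  · exact ⟨y, v, hv, by simp, fun h => absurd hv h⟩
  · have := mt (hM y v) hv
    push Not at this
    obtain ⟨x, u, hu, hlt⟩ := this
    exact ⟨x, u, hu, hlt.le, fun _ => hlt⟩

/-- If `R` is a self-adjoint square root of `U` and `T` is a right inverse of `U`, then the
quadratic form of `T` is `x ↦ ‖x'‖ ^ 2` for a preimage `x'` of `x` under `R`. -/
theorem exists_sqrt_preimage {U T R : E →L[ℝ] E} {K : ℝ} (hUT : ∀ x, U (T x) = x)
    (hR : ∀ x y, ⟪R x, y⟫ = ⟪x, R y⟫) (hRR : ∀ x, R (R x) = U x) (hU : ‖U‖ ≤ K) (x : E) :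
    ∃ x' : E, R x' = x ∧ ⟪T x, x⟫ = ‖x'‖ ^ 2 ∧ ‖x‖ ^ 2 ≤ K * ‖x'‖ ^ 2 := by
  have e1 : R (R (T x)) = x := by rw [hRR, hUT]
  refine ⟨R (T x), e1, ?_, ?_⟩
  · rw [← real_inner_self_eq_norm_sq, hR, e1]
  · have e2 : ‖x‖ ^ 2 = ⟪U (R (T x)), R (T x)⟫ := by
      rw [← hRR, e1, hR, e1, real_inner_self_eq_norm_sq]
    rw [e2]
    refine (real_inner_le_norm _ _).trans ?_
    have := mul_le_mul_of_nonneg_right ((U.le_opNorm (R (T x))).trans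
      (mul_le_mul_of_nonneg_right hU (norm_nonneg _))) (norm_nonneg (R (T x)))
    linarith

end Inverse

section Norm

variable {H : Type*} [NormedAddCommGroup H] {ι : Type*} [Fintype ι] {G : ι → Type*}
  [∀ i, NormedAddCommGroup (G i)]

theorem WithLp.norm_sq_prod_pi (ξ : WithLp 2 (H × PiLp 2 G)) :
    ‖ξ‖ ^ 2 = ‖ξ.fst‖ ^ 2 + ∑ i, ‖ξ.snd i‖ ^ 2 := by
  rw [WithLp.prod_norm_sq_eq_of_L2, PiLp.norm_sq_eq_of_L2]

theorem WithLp.norm_prod_pi_le (ξ : WithLp 2 (H × PiLp 2 G)) :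
    ‖ξ‖ ≤ ‖ξ.fst‖ + ∑ i, ‖ξ.snd i‖ := by
  refine le_of_sq_le_sq ?_ (by positivity)
  have h1 : ∑ i, ‖ξ.snd i‖ ^ 2 ≤ (∑ i, ‖ξ.snd i‖) ^ 2 :=
    Finset.sum_sq_le_sq_sum_of_nonneg fun i _ => norm_nonneg _
  have h2 : 0 ≤ ‖ξ.fst‖ * ∑ i, ‖ξ.snd i‖ := by positivity
  rw [WithLp.norm_sq_prod_pi]
  linarith

theorem WithLp.summable_norm_prod_pi {ξ : ℕ → WithLp 2 (H × PiLp 2 G)}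
    (h1 : Summable fun n => ‖(ξ n).fst‖) (h2 : ∀ i, Summable fun n => ‖(ξ n).snd i‖) :
    Summable fun n => ‖ξ n‖ :=
  Summable.of_nonneg_of_le (fun _ => norm_nonneg _) (fun n => WithLp.norm_prod_pi_le (ξ n))
    (h1.add (summable_sum fun i _ => h2 i))

end Norm

section Product

variable {H : Type*} [NormedAddCommGroup H] [InnerProductSpace ℝ H]
  {ι : Type*} [Fintype ι] {G : ι → Type*} [∀ i, NormedAddCommGroup (G i)]
  [∀ i, InnerProductSpace ℝ (G i)]

theorem WithLp.inner_prod_pi (ξ η : WithLp 2 (H × PiLp 2 G)) :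
    ⟪ξ, η⟫ = ⟪ξ.fst, η.fst⟫ + ∑ i, ⟪ξ.snd i, η.snd i⟫ := by
  rw [WithLp.prod_inner_apply, PiLp.inner_apply]
  rfl

/-- The product of finitely many maximally monotone operators is maximally monotone. -/
theorem prod_maximally_monotone {A : H → Set H}
    (hA : ∀ y v : H, (∀ x u : H, u ∈ A x → ⟪x - y, u - v⟫ ≥ 0) → v ∈ A y)
    {B : ∀ i, G i → Set (G i)}
    (hB : ∀ i, ∀ y v : G i, (∀ x u : G i, u ∈ B i x → ⟪x - y, u - v⟫ ≥ 0) → v ∈ B i y)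
    {x u : H} {y v : ∀ i, G i}
    (h : ∀ x' u', u' ∈ A x' → ∀ y' v' : ∀ i, G i, (∀ i, v' i ∈ B i (y' i)) →
      0 ≤ ⟪x' - x, u' - u⟫ + ∑ i, ⟪y' i - y i, v' i - v i⟫) :
    u ∈ A x ∧ ∀ i, v i ∈ B i (y i) := by
  have key := fun i => exists_inner_nonpos_of_maximal (hB i) (y i) (v i)
  obtain ⟨x', u', hu', hle, hlt⟩ := exists_inner_nonpos_of_maximal hA x u
  choose y' v' hv' hle' hlt' using key
  have h0 := h x' u' hu' y' v' hv'
  constructor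
  · by_contra hn
    have := Finset.sum_nonpos fun i (_ : i ∈ Finset.univ) => hle' i
    linarith [hlt hn]
  · intro j
    by_contra hn
    have := Finset.sum_lt_sum (fun i (_ : i ∈ Finset.univ) => hle' i)
      ⟨j, Finset.mem_univ j, hlt' j hn⟩
    rw [Finset.sum_const_zero] at this
    linarith

theorem cocoercive_maximal {μ : ℝ} (hμ : 0 < μ) {C : H → H}
    (hC : ∀ x y : H, ⟪x - y, C x - C y⟫ ≥ μ * ‖C x - C y‖ ^ 2) {y v : H}
    (h : ∀ x : H, ⟪x - y, C x - v⟫ ≥ 0) : v = C y := by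
  set k := v - C y with hk
  have h1 := h (y + (μ / 2) • k)
  have h2 := hC (y + (μ / 2) • k) y
  set w := C (y + (μ / 2) • k) - C y with hw
  have h3 : C (y + (μ / 2) • k) - v = w - k := by rw [hw, hk]; abel
  rw [h3] at h1
  simp only [add_sub_cancel_left, inner_smul_left, RCLike.conj_to_real, inner_sub_right,
    real_inner_self_eq_norm_sq] at h1 h2
  have h4 := real_inner_le_norm k w
  have h5 : ‖k‖ ^ 2 ≤ ⟪k, w⟫ := by nlinarith
  have h6 : 2 * ‖w‖ ^ 2 ≤ ⟪k, w⟫ := by nlinarith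
  have h7 : ‖k‖ = 0 := by nlinarith [norm_nonneg k, norm_nonneg w, sq_nonneg (‖k‖ - ‖w‖)]
  exact sub_eq_zero.1 (norm_eq_zero.1 h7)

variable [CompleteSpace H] [∀ i, CompleteSpace (G i)]

/-- The skew-adjoint part of a primal-dual operator does not contribute to inner products. -/
theorem inner_primal_dual_eq (L : ∀ i, H →L[ℝ] G i) (z : H) (r : ∀ i, G i)
    (ξ ζ u w : WithLp 2 (H × PiLp 2 G)) :
    ⟪ξ - ζ, u - w⟫ =
      ⟪ξ.fst - ζ.fst, (u.fst + z - ∑ i, (ContinuousLinearMap.adjoint (L i)) (ξ.snd i)) -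
          (w.fst + z - ∑ i, (ContinuousLinearMap.adjoint (L i)) (ζ.snd i))⟫ +
        ∑ i, ⟪(u.snd i - r i + L i ξ.fst) - (w.snd i - r i + L i ζ.fst),
          ξ.snd i - ζ.snd i⟫ := by
  have h1 : (u.fst + z - ∑ i, (ContinuousLinearMap.adjoint (L i)) (ξ.snd i)) -
      (w.fst + z - ∑ i, (ContinuousLinearMap.adjoint (L i)) (ζ.snd i)) =
      (u.fst - w.fst) - ∑ i, (ContinuousLinearMap.adjoint (L i)) (ξ.snd i - ζ.snd i) := by
    simp only [map_sub, Finset.sum_sub_distrib]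
    abel
  have h2 : ∀ i, ⟪(u.snd i - r i + L i ξ.fst) - (w.snd i - r i + L i ζ.fst),
      ξ.snd i - ζ.snd i⟫ = ⟪ξ.snd i - ζ.snd i, u.snd i - w.snd i⟫ +
        ⟪L i (ξ.fst - ζ.fst), ξ.snd i - ζ.snd i⟫ := fun i => by
    rw [← real_inner_comm (ξ.snd i - ζ.snd i) (u.snd i - w.snd i), ← inner_add_left, map_sub]
    congr 1
    abel
  rw [WithLp.inner_prod_pi, h1, inner_sub_right, inner_sum]
  simp only [h2, Finset.sum_add_distrib, ContinuousLinearMap.adjoint_inner_right,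
    WithLp.sub_fst, WithLp.sub_snd, PiLp.sub_apply]
  ring

/-- The block operator `(x, v) ↦ (T x - ∑ᵢ Lᵢ* vᵢ, (Wᵢ vᵢ - Lᵢ x)ᵢ)`. -/
noncomputable def primalDualMetric (L : ∀ i, H →L[ℝ] G i) (T : H →L[ℝ] H)
    (W : ∀ i, G i →L[ℝ] G i) :
    WithLp 2 (H × PiLp 2 G) →ₗ[ℝ] WithLp 2 (H × PiLp 2 G) where
  toFun ξ := WithLp.toLp 2 (T ξ.fst - ∑ i, (ContinuousLinearMap.adjoint (L i)) (ξ.snd i),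
    WithLp.toLp 2 fun i => W i (ξ.snd i) - L i ξ.fst)
  map_add' ξ η := by
    refine WithLp.ofLp_injective 2 (Prod.ext ?_ (PiLp.ext fun i => ?_))
    · simp [Finset.sum_add_distrib]
      abel
    · simp
      abel
  map_smul' τ ξ := by
    refine WithLp.ofLp_injective 2 (Prod.ext ?_ (PiLp.ext fun i => ?_))
    · simp [Finset.smul_sum, smul_sub]
    · simp [smul_sub]

theorem inner_primalDualMetric (L : ∀ i, H →L[ℝ] G i) (T : H →L[ℝ] H)
    (W : ∀ i, G i →L[ℝ] G i) (ξ η : WithLp 2 (H × PiLp 2 G)) :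
    ⟪primalDualMetric L T W ξ, η⟫ = ⟪T ξ.fst, η.fst⟫ + ∑ i, ⟪W i (ξ.snd i), η.snd i⟫ -
      ∑ i, (⟪ξ.snd i, L i η.fst⟫ + ⟪L i ξ.fst, η.snd i⟫) := by
  rw [WithLp.inner_prod_pi]
  simp only [primalDualMetric, LinearMap.coe_mk, AddHom.coe_mk, WithLp.toLp_fst, WithLp.toLp_snd,
    inner_sub_left, sum_inner, ContinuousLinearMap.adjoint_inner_left, Finset.sum_sub_distrib,
    Finset.sum_add_distrib]
  ring

theorem primalDualMetric_isSymmetric (L : ∀ i, H →L[ℝ] G i) {T : H →L[ℝ] H}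
    {W : ∀ i, G i →L[ℝ] G i} (hT : ∀ x y, ⟪T x, y⟫ = ⟪x, T y⟫)
    (hW : ∀ i x y, ⟪W i x, y⟫ = ⟪x, W i y⟫) : (primalDualMetric L T W).IsSymmetric := by
  intro ξ η
  rw [← real_inner_comm ξ (primalDualMetric L T W η), inner_primalDualMetric,
    inner_primalDualMetric, hT, real_inner_comm]
  have h1 : ∀ i, ⟪W i (ξ.snd i), η.snd i⟫ = ⟪W i (η.snd i), ξ.snd i⟫ := fun i => by
    rw [hW, real_inner_comm]
  have h2 : ∀ i, ⟪ξ.snd i, L i η.fst⟫ + ⟪L i ξ.fst, η.snd i⟫ =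
      ⟪η.snd i, L i ξ.fst⟫ + ⟪L i η.fst, ξ.snd i⟫ := fun i => by
    rw [real_inner_comm, real_inner_comm (η.snd i) (L i ξ.fst), add_comm]
  simp only [h1, h2]

theorem primalDualMetric_anti (L : ∀ i, H →L[ℝ] G i) {T T' : H →L[ℝ] H}
    {W W' : ∀ i, G i →L[ℝ] G i} (hT : ∀ x, ⟪T' x, x⟫ ≤ ⟪T x, x⟫)
    (hW : ∀ i x, ⟪W' i x, x⟫ ≤ ⟪W i x, x⟫) (ξ : WithLp 2 (H × PiLp 2 G)) :
    ⟪primalDualMetric L T' W' ξ, ξ⟫ ≤ ⟪primalDualMetric L T W ξ, ξ⟫ := by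
  rw [inner_primalDualMetric, inner_primalDualMetric]
  have := Finset.sum_le_sum fun i (_ : i ∈ Finset.univ) => hW i (ξ.snd i)
  linarith [hT ξ.fst]

theorem le_inner_primalDualMetric (L : ∀ i, H →L[ℝ] G i) {U T R : H →L[ℝ] H}
    {Q W S : ∀ i, G i →L[ℝ] G i} {θ K : ℝ} (hθ : 0 ≤ θ)
    (hUT : ∀ x, U (T x) = x) (hQW : ∀ i x, Q i (W i x) = x)
    (hR : ∀ x y, ⟪R x, y⟫ = ⟪x, R y⟫) (hS : ∀ i x y, ⟪S i x, y⟫ = ⟪x, S i y⟫)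
    (hRR : ∀ x, R (R x) = U x) (hSS : ∀ i x, S i (S i x) = Q i x)
    (hU : ‖U‖ ≤ K) (hQ : ∀ i, ‖Q i‖ ≤ K)
    (hθK : θ * K ≤ 1 - √(∑ i, ‖(S i).comp ((L i).comp R)‖ ^ 2))
    (ξ : WithLp 2 (H × PiLp 2 G)) :
    θ * ‖ξ‖ ^ 2 ≤ ⟪primalDualMetric L T W ξ, ξ⟫ := by
  set c : ι → ℝ := fun i => ‖(S i).comp ((L i).comp R)‖ with hc
  set s := √(∑ i, c i ^ 2) with hs
  have hs0 : 0 ≤ s := Real.sqrt_nonneg _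
  obtain ⟨x', hx', hTx, hxK⟩ := exists_sqrt_preimage hUT hR hRR hU ξ.fst
  choose y' hy' hWy hyK using fun i =>
    exists_sqrt_preimage (hQW i) (hS i) (hSS i) (hQ i) (ξ.snd i)
  have hin : ∀ i, ⟪ξ.snd i, L i ξ.fst⟫ ≤ ‖x'‖ * (c i * ‖y' i‖) := fun i => by
    rw [← hy' i, ← hx', hS]
    refine (real_inner_le_norm _ _).trans ?_
    have := mul_le_mul_of_nonneg_left (((S i).comp ((L i).comp R)).le_opNorm x')
      (norm_nonneg (y' i))
    simp only [ContinuousLinearMap.comp_apply] at this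
    linarith
  have hcs : ∑ i, c i * ‖y' i‖ ≤ s * √(∑ i, ‖y' i‖ ^ 2) := Real.sum_mul_le_sqrt_mul_sqrt _ _ _
  set Y := √(∑ i, ‖y' i‖ ^ 2)
  have hY : Y ^ 2 = ∑ i, ‖y' i‖ ^ 2 := Real.sq_sqrt (Finset.sum_nonneg fun i _ => sq_nonneg _)
  have hsum : ∑ i, ⟪ξ.snd i, L i ξ.fst⟫ ≤ ‖x'‖ * (s * Y) := by
    refine (Finset.sum_le_sum fun i _ => hin i).trans ?_
    rw [← Finset.mul_sum]
    exact mul_le_mul_of_nonneg_left hcs (norm_nonneg _)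
  have hnorm : ‖ξ‖ ^ 2 ≤ K * (‖x'‖ ^ 2 + Y ^ 2) := by
    rw [WithLp.norm_sq_prod_pi, mul_add, hY, Finset.mul_sum]
    exact add_le_add hxK (Finset.sum_le_sum fun i _ => hyK i)
  have hcomm : ∀ i, ⟪L i ξ.fst, ξ.snd i⟫ = ⟪ξ.snd i, L i ξ.fst⟫ := fun i => real_inner_comm _ _
  rw [inner_primalDualMetric, hTx]
  simp only [hWy, hcomm, Finset.sum_add_distrib]
  rw [← hY]
  have h1 := mul_le_mul_of_nonneg_left hnorm hθ
  have h2 : θ * K * (‖x'‖ ^ 2 + Y ^ 2) ≤ (1 - s) * (‖x'‖ ^ 2 + Y ^ 2) :=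
    mul_le_mul_of_nonneg_right hθK (by positivity)
  nlinarith [mul_nonneg hs0 (sq_nonneg (‖x'‖ - Y))]

end Product

theorem mul_le_one_sub_of_le_div {δ s K θ : ℝ} (hθ : 0 < θ) (hs : 0 ≤ s) (hK : 0 ≤ K)
    (hδ : δ = 1 / s - 1) (h : θ ≤ δ / ((1 + δ) * K)) : θ * K ≤ 1 - s := by
  rw [show 1 + δ = 1 / s by linarith, hδ] at h
  rcases hs.eq_or_lt with rfl | hs
  · simp at h
    linarith
  rcases hK.eq_or_lt with rfl | hK
  · simp at h
    linarith
  · rwa [show (1 / s - 1) / (1 / s * K) = (1 - s) / K by field_simp, le_div_iff₀ hK] at h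

section Operators

variable {H : Type*} [NormedAddCommGroup H] [InnerProductSpace ℝ H]
  {ι : Type*} [Fintype ι] {G : ι → Type*} [∀ i, NormedAddCommGroup (G i)]
  [∀ i, InnerProductSpace ℝ (G i)]

/-- The set-valued operator `(x, v) ↦ {C x} × ∏ᵢ Dᵢ⁻¹ vᵢ`. -/
def cocoerciveSetOperator (C : H → H) (D : ∀ i, G i → Set (G i))
    (ξ : WithLp 2 (H × PiLp 2 G)) : Set (WithLp 2 (H × PiLp 2 G)) :=
  {g | g.fst = C ξ.fst ∧ ∀ i, ξ.snd i ∈ D i (g.snd i)}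

theorem cocoerciveSetOperator_cocoercive {C : H → H} {μ β : ℝ}
    (hC : ∀ x y : H, ⟪x - y, C x - C y⟫ ≥ μ * ‖C x - C y‖ ^ 2) {D : ∀ i, G i → Set (G i)}
    {ν : ι → ℝ} (hD : ∀ i, ∀ x y u v : G i, u ∈ D i x → v ∈ D i y →
      ⟪x - y, u - v⟫ ≥ ν i * ‖x - y‖ ^ 2) (hμ : β ≤ μ) (hν : ∀ i, β ≤ ν i)
    (ξ ζ u w : WithLp 2 (H × PiLp 2 G)) (hu : u ∈ cocoerciveSetOperator C D ξ)
    (hw : w ∈ cocoerciveSetOperator C D ζ) : ⟪ξ - ζ, u - w⟫ ≥ β * ‖u - w‖ ^ 2 := by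
  rw [WithLp.inner_prod_pi, WithLp.norm_sq_prod_pi, mul_add, Finset.mul_sum]
  refine add_le_add ?_ (Finset.sum_le_sum fun i _ => ?_)
  · rw [WithLp.sub_fst, WithLp.sub_fst, hu.1, hw.1]
    exact (mul_le_mul_of_nonneg_right hμ (sq_nonneg _)).trans (hC _ _)
  · rw [real_inner_comm]
    exact (mul_le_mul_of_nonneg_right (hν i) (sq_nonneg _)).trans
      (hD i _ _ _ _ (hu.2 i) (hw.2 i))

theorem cocoerciveSetOperator_maximal {C : H → H} {μ : ℝ} (hμ : 0 < μ)
    (hC : ∀ x y : H, ⟪x - y, C x - C y⟫ ≥ μ * ‖C x - C y‖ ^ 2) {D : ∀ i, G i → Set (G i)}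
    (hD : ∀ i, ∀ y v : G i, (∀ x u : G i, u ∈ D i x → ⟪x - y, u - v⟫ ≥ 0) → v ∈ D i y)
    (ζ w : WithLp 2 (H × PiLp 2 G))
    (h : ∀ ξ u, u ∈ cocoerciveSetOperator C D ξ → ⟪ξ - ζ, u - w⟫ ≥ 0) :
    w ∈ cocoerciveSetOperator C D ζ := by
  refine prod_maximally_monotone (A := fun x => {C x})
    (fun y v h => cocoercive_maximal hμ hC fun x => h x _ rfl) hD fun x' u' hu' y' v' hv' => ?_
  have := h (WithLp.toLp 2 (x', WithLp.toLp 2 v')) (WithLp.toLp 2 (u', WithLp.toLp 2 y'))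
    ⟨hu', hv'⟩
  rw [WithLp.inner_prod_pi] at this
  simpa [real_inner_comm] using this

variable [CompleteSpace H] [∀ i, CompleteSpace (G i)]

/-- The set-valued operator
`(x, v) ↦ (-z + A x + ∑ᵢ Lᵢ* vᵢ) × ∏ᵢ (rᵢ + Bᵢ⁻¹ vᵢ - Lᵢ x)`. -/
def primalDualSetOperator (A : H → Set H) (B : ∀ i, G i → Set (G i)) (L : ∀ i, H →L[ℝ] G i)
    (z : H) (r : ∀ i, G i) (ξ : WithLp 2 (H × PiLp 2 G)) : Set (WithLp 2 (H × PiLp 2 G)) :=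
  {w | w.fst + z - ∑ i, (ContinuousLinearMap.adjoint (L i)) (ξ.snd i) ∈ A ξ.fst ∧
    ∀ i, ξ.snd i ∈ B i (w.snd i - r i + L i ξ.fst)}

theorem primalDualSetOperator_monotone {A : H → Set H}
    (hA : ∀ x y u v : H, u ∈ A x → v ∈ A y → ⟪x - y, u - v⟫ ≥ 0) {B : ∀ i, G i → Set (G i)}
    (hB : ∀ i, ∀ x y u v : G i, u ∈ B i x → v ∈ B i y → ⟪x - y, u - v⟫ ≥ 0)
    (L : ∀ i, H →L[ℝ] G i) (z : H) (r : ∀ i, G i) (ξ ζ u w : WithLp 2 (H × PiLp 2 G))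
    (hu : u ∈ primalDualSetOperator A B L z r ξ) (hw : w ∈ primalDualSetOperator A B L z r ζ) :
    ⟪ξ - ζ, u - w⟫ ≥ 0 := by
  rw [inner_primal_dual_eq L z r]
  exact add_nonneg (hA _ _ _ _ hu.1 hw.1)
    (Finset.sum_nonneg fun i _ => hB i _ _ _ _ (hu.2 i) (hw.2 i))

theorem primalDualSetOperator_maximal {A : H → Set H}
    (hA : ∀ y v : H, (∀ x u : H, u ∈ A x → ⟪x - y, u - v⟫ ≥ 0) → v ∈ A y)
    {B : ∀ i, G i → Set (G i)}
    (hB : ∀ i, ∀ y v : G i, (∀ x u : G i, u ∈ B i x → ⟪x - y, u - v⟫ ≥ 0) → v ∈ B i y)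
    (L : ∀ i, H →L[ℝ] G i) (z : H) (r : ∀ i, G i) (ζ w : WithLp 2 (H × PiLp 2 G))
    (h : ∀ ξ u, u ∈ primalDualSetOperator A B L z r ξ → ⟪ξ - ζ, u - w⟫ ≥ 0) :
    w ∈ primalDualSetOperator A B L z r ζ := by
  have e1 : ∀ u s : H, u - z + s + z - s = u := fun u s => by abel
  have e2 : ∀ i, ∀ y s : G i, y + r i - s - r i + s = y := fun i y s => by abel
  refine prod_maximally_monotone hA hB fun x' u' hu' y' v' hv' => ?_
  have := h (WithLp.toLp 2 (x', WithLp.toLp 2 v'))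
    (WithLp.toLp 2 (u' - z + ∑ i, (ContinuousLinearMap.adjoint (L i)) (v' i),
      WithLp.toLp 2 fun i => y' i + r i - L i x'))
    ⟨by simpa [e1] using hu', fun i => by simpa [e2] using hv' i⟩
  rw [inner_primal_dual_eq L z r] at this
  simpa [e1, e2] using this

end Operators

/-- **Variable metric primal–dual algorithm for cocoercive composite inclusions:
weak convergence and strong convergence under demiregularity.** Under the cocoercive
composite setup with its range condition and the variable metric primal–dual iteration,
the primal and dual iterates converge weakly to a primal solution `xb` and a dual
solution `vb`; moreover, if `C` is demiregular at `xb` then `x n → xb` strongly, and if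
`Dⱼ⁻¹` is demiregular at `vb j` then `v j n → vb j` strongly. -/
theorem cocoercive_primal_dual_strong_demiregular
    {H : Type*} [NormedAddCommGroup H] [InnerProductSpace ℝ H] [CompleteSpace H]
    {m : ℕ} (hm : 0 < m)
    (G : Fin m → Type*) [∀ i, NormedAddCommGroup (G i)] [∀ i, InnerProductSpace ℝ (G i)]
    [∀ i, CompleteSpace (G i)]
    (z : H)
    (A : H → Set H)
    (hAmono : ∀ x y u v : H, u ∈ A x → v ∈ A y → ⟪x - y, u - v⟫ ≥ 0)
    (hAmax : ∀ y v : H, (∀ x u : H, u ∈ A x → ⟪x - y, u - v⟫ ≥ 0) → v ∈ A y)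
    (μc : ℝ) (hμc : 0 < μc)
    (C : H → H)
    (hC : ∀ x y : H, ⟪x - y, C x - C y⟫ ≥ μc * ‖C x - C y‖ ^ 2)
    (r : ∀ i, G i)
    (Bop : ∀ i, G i → Set (G i))
    (hBmono : ∀ i, ∀ x y u v : G i, u ∈ Bop i x → v ∈ Bop i y → ⟪x - y, u - v⟫ ≥ 0)
    (hBmax : ∀ i, ∀ y v : G i, (∀ x u : G i, u ∈ Bop i x → ⟪x - y, u - v⟫ ≥ 0) → v ∈ Bop i y)
    (ν : Fin m → ℝ) (hν : ∀ i, 0 < ν i)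
    (D : ∀ i, G i → Set (G i))
    (hDstrong : ∀ i, ∀ x y u v : G i, u ∈ D i x → v ∈ D i y →
      ⟪x - y, u - v⟫ ≥ ν i * ‖x - y‖ ^ 2)
    (hDmax : ∀ i, ∀ y v : G i, (∀ x u : G i, u ∈ D i x → ⟪x - y, u - v⟫ ≥ 0) → v ∈ D i y)
    (L : ∀ i, H →L[ℝ] G i) (hL : ∀ i, L i ≠ 0)
    (PrimalSol : H → Prop)
    (hPrimal : ∀ xb : H, PrimalSol xb ↔
      ∃ a ∈ A xb, ∃ w : (i : Fin m) → G i,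
        (∀ i, ∃ pp qq : G i, w i ∈ Bop i pp ∧ w i ∈ D i qq ∧ L i xb - r i = pp + qq) ∧
        z = a + ∑ i, (ContinuousLinearMap.adjoint (L i)) (w i) + C xb)
    (hrange : ∃ xb : H, PrimalSol xb)
    (DualSol : ((i : Fin m) → G i) → Prop)
    (hDualSol : ∀ v : (i : Fin m) → G i, DualSol v ↔
      ∃ x : H, (z - ∑ j, (ContinuousLinearMap.adjoint (L j)) (v j) - C x ∈ A x) ∧
        ∀ i, ∃ pp qq : G i, v i ∈ Bop i pp ∧ v i ∈ D i qq ∧ L i x - r i = pp + qq)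
    (β : ℝ) (hβ : β = min μc (⨅ i, ν i))
    (ε : ℝ) (hε : ε ∈ Set.Ioo 0 (min 1 β))
    (α : ℝ) (hα : 0 < α)
    (lam : ℕ → ℝ) (hlam : ∀ n, lam n ∈ Set.Icc ε 1)
    (a c : ℕ → H) (ha : Summable fun n => ‖a n‖) (hc : Summable fun n => ‖c n‖)
    (U : ℕ → H →L[ℝ] H) (hUsa : ∀ n, IsSelfAdjoint (U n))
    (hUα : ∀ n (x : H), ⟪U n x, x⟫ ≥ α * ‖x‖ ^ 2)
    (hUmono : ∀ n (x : H), ⟪U (n + 1) x, x⟫ ≥ ⟪U n x, x⟫)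
    (b d : ∀ i, ℕ → G i)
    (hb : ∀ i, Summable fun n => ‖b i n‖) (hd : ∀ i, Summable fun n => ‖d i n‖)
    (Uop : ∀ i, ℕ → (G i →L[ℝ] G i))
    (hUopsa : ∀ i n, IsSelfAdjoint (Uop i n))
    (hUopα : ∀ i n (v : G i), ⟪Uop i n v, v⟫ ≥ α * ‖v‖ ^ 2)
    (hUopmono : ∀ i n (v : G i), ⟪Uop i (n + 1) v, v⟫ ≥ ⟪Uop i n v, v⟫)
    (R : ℕ → H →L[ℝ] H)
    (hRsa : ∀ n, IsSelfAdjoint (R n)) (hRpos : ∀ n (x : H), ⟪R n x, x⟫ ≥ 0)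
    (hRsq : ∀ n, (R n).comp (R n) = U n)
    (S : ∀ i, ℕ → (G i →L[ℝ] G i))
    (hSsa : ∀ i n, IsSelfAdjoint (S i n)) (hSpos : ∀ i n (v : G i), ⟪S i n v, v⟫ ≥ 0)
    (hSsq : ∀ i n, (S i n).comp (S i n) = Uop i n)
    (δ : ℕ → ℝ)
    (hδ : ∀ n, δ n = 1 / Real.sqrt (∑ i, ‖(S i n).comp ((L i).comp (R n))‖ ^ 2) - 1)
    (hcond : ∀ n,
      δ n / ((1 + δ n) * max ‖U n‖ (⨆ i, ‖Uop i n‖)) ≥ 1 / (2 * β - ε))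
    (x p π y : ℕ → H) (v q t κ : ∀ i, ℕ → G i)
    (hπ : ∀ n, (x n - U n ((∑ i, (ContinuousLinearMap.adjoint (L i)) (v i n)) +
        C (x n) + c n - z)) - π n ∈ (fun u => U n u) '' A (π n))
    (hpdef : ∀ n, p n = π n + a n)
    (hydef : ∀ n, y n = (2 : ℝ) • p n - x n)
    (hxrec : ∀ n, x (n + 1) = x n + lam n • (p n - x n))
    (ht : ∀ i n, v i n ∈ D i (t i n))
    (hκ : ∀ i n, ∃ u : G i, κ i n ∈ Bop i u ∧
      (v i n + Uop i n (L i (y n) - t i n - d i n - r i)) - κ i n = Uop i n u)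
    (hq : ∀ i n, q i n = κ i n + b i n)
    (hvrec : ∀ i n, v i (n + 1) = v i n + lam n • (q i n - v i n)) :
    ∃ (xb : H) (vb : (i : Fin m) → G i), PrimalSol xb ∧ DualSol vb ∧
      (∀ w : H, Tendsto (fun n => ⟪x n, w⟫) atTop (𝓝 ⟪xb, w⟫)) ∧
      (∀ i, ∀ w' : G i, Tendsto (fun n => ⟪v i n, w'⟫) atTop (𝓝 ⟪vb i, w'⟫)) ∧
      (Demiregular (fun w => {C w}) xb → Tendsto x atTop (𝓝 xb)) ∧
      (∀ j, Demiregular (fun w => {s : G j | w ∈ D j s}) (vb j) →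
        Tendsto (v j) atTop (𝓝 (vb j))) := by
  have hβpos : 0 < β := hε.1.trans (hε.2.trans_le (min_le_right _ _))
  have hεβ : ε < β := hε.2.trans_le (min_le_right _ _)
  have hβμ : β ≤ μc := hβ.trans_le (min_le_left _ _)
  have hβν : ∀ i, β ≤ ν i := fun i =>
    (hβ.trans_le (min_le_right _ _)).trans (ciInf_le (Set.finite_range ν).bddBelow i)
  have hθpos : 0 < 1 / (2 * β - ε) := by
    have : 0 < 2 * β - ε := by linarith
    positivity
  have hθβ : 1 < 2 * β * (1 / (2 * β - ε)) := by
    rw [mul_one_div, one_lt_div (by linarith)]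
    linarith [hε.1]
  set θ := 1 / (2 * β - ε)
  have hUs : ∀ n x y, ⟪U n x, y⟫ = ⟪x, U n y⟫ := fun n =>
    ContinuousLinearMap.isSelfAdjoint_iff_isSymmetric.1 (hUsa n)
  have hQs : ∀ i n x y, ⟪Uop i n x, y⟫ = ⟪x, Uop i n y⟫ := fun i n =>
    ContinuousLinearMap.isSelfAdjoint_iff_isSymmetric.1 (hUopsa i n)
  have hRs : ∀ n x y, ⟪R n x, y⟫ = ⟪x, R n y⟫ := fun n =>
    ContinuousLinearMap.isSelfAdjoint_iff_isSymmetric.1 (hRsa n)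
  have hSs : ∀ i n x y, ⟪S i n x, y⟫ = ⟪x, S i n y⟫ := fun i n =>
    ContinuousLinearMap.isSelfAdjoint_iff_isSymmetric.1 (hSsa i n)
  choose T hUT hTU using fun n => ContinuousLinearMap.exists_inverse_of_coercive hα (hUα n)
  choose W hQW hWQ using fun i n => ContinuousLinearMap.exists_inverse_of_coercive hα (hUopα i n)
  have hV : ∀ n, (primalDualMetric L (T n) fun i => W i n).IsSymmetric := fun n =>
    primalDualMetric_isSymmetric L (inner_right_inverse_comm (hUs n) (hUT n)) fun i =>
      inner_right_inverse_comm (hQs i n) (hQW i n)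
  have hVanti : ∀ n ξ, ⟪primalDualMetric L (T (n + 1)) (fun i => W i (n + 1)) ξ, ξ⟫ ≤
      ⟪primalDualMetric L (T n) (fun i => W i n) ξ, ξ⟫ := fun n =>
    primalDualMetric_anti L
      (inner_right_inverse_anti (hUs n) (fun x => le_trans (by positivity) (hUα n x))
        (hUmono n) (hUT n) (hUT (n + 1)))
      fun i => inner_right_inverse_anti (hQs i n)
        (fun x => le_trans (by positivity) (hUopα i n x)) (hUopmono i n) (hQW i n) (hQW i (n + 1))
  have hVθ : ∀ n ξ, θ * ‖ξ‖ ^ 2 ≤ ⟪primalDualMetric L (T n) (fun i => W i n) ξ, ξ⟫ := fun n =>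
    le_inner_primalDualMetric L hθpos.le (hUT n) (fun i => hQW i n) (hRs n) (fun i => hSs i n)
      (fun x => DFunLike.congr_fun (hRsq n) x) (fun i x => DFunLike.congr_fun (hSsq i n) x)
      (le_max_left _ _)
      (fun i => (le_ciSup (f := fun i => ‖Uop i n‖) (Set.finite_range _).bddAbove i).trans
        (le_max_right _ _))
      (mul_le_one_sub_of_le_div hθpos (Real.sqrt_nonneg _)
        ((norm_nonneg _).trans (le_max_left _ _)) (hδ n) (hcond n))
  obtain ⟨xs, hxs⟩ := hrange
  obtain ⟨as, has, ws, hws, hzs⟩ := (hPrimal xs).1 hxs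
  choose ps qs hps hqs hpq using hws
  obtain ⟨ξ, g, hgN, hgM, hweak, hstrong⟩ := forward_backward_weak_convergence
    (E := WithLp 2 (H × PiLp 2 G)) (M := primalDualSetOperator A Bop L z r)
    (N := cocoerciveSetOperator C D) hβpos hθpos hθβ hε.1
    (primalDualSetOperator_monotone hAmono hBmono L z r)
    (primalDualSetOperator_maximal hAmax hBmax L z r)
    (cocoerciveSetOperator_cocoercive hC hDstrong hβμ hβν)
    (cocoerciveSetOperator_maximal hμc hC hDmax)
    ⟨WithLp.toLp 2 (xs, WithLp.toLp 2 ws), WithLp.toLp 2 (C xs, WithLp.toLp 2 qs), ⟨rfl, hqs⟩,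
      by
        have : -C xs + z - ∑ i, (ContinuousLinearMap.adjoint (L i)) (ws i) = as := by
          rw [hzs]
          abel
        simpa [this] using has,
      fun i => by
        have : -qs i - r i + L i xs = ps i := by
          rw [sub_add_eq_add_sub, neg_add_eq_sub, sub_right_comm, hpq, add_sub_cancel_right]
        simpa [this] using hps i⟩
    hV hVθ hVanti hlam
    (ζ := fun n => WithLp.toLp 2 (x n, WithLp.toLp 2 fun i => v i n))
    (ρ := fun n => WithLp.toLp 2 (π n, WithLp.toLp 2 fun i => κ i n))
    (e := fun n => WithLp.toLp 2 (-c n, WithLp.toLp 2 fun i => (2 : ℝ) • L i (a n) - d i n))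
    (f := fun n => WithLp.toLp 2 (a n, WithLp.toLp 2 fun i => b i n))
    (g := fun n => WithLp.toLp 2 (C (x n), WithLp.toLp 2 fun i => t i n))
    (WithLp.summable_norm_prod_pi (by simpa using hc) fun i => by
      refine Summable.of_nonneg_of_le (fun _ => norm_nonneg _) (fun n => ?_)
        ((ha.mul_left (2 * ‖L i‖)).add (hd i))
      refine (norm_sub_le _ _).trans (add_le_add_left ?_ _)
      rw [norm_smul, Real.norm_ofNat, mul_assoc]
      exact mul_le_mul_of_nonneg_left ((L i).le_opNorm _) zero_le_two)
    (WithLp.summable_norm_prod_pi ha hb)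
    (fun n => by
      refine WithLp.ofLp_injective 2 (Prod.ext ?_ (PiLp.ext fun i => ?_))
      · simp [hxrec, hpdef]
      · simp [hvrec, hq])
    (fun n => ⟨rfl, fun i => ht i n⟩)
    (fun n => by
      obtain ⟨u, hu, hun⟩ := hπ n
      refine ⟨?_, fun i => ?_⟩
      · change T n (x n - π n) - ∑ i, (ContinuousLinearMap.adjoint (L i)) (v i n - κ i n) + -c n -
          C (x n) + z - ∑ i, (ContinuousLinearMap.adjoint (L i)) (κ i n) ∈ A (π n)
        have h1 := congrArg (T n) hun
        simp only [map_sub, hTU] at h1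
        convert hu using 1
        rw [h1]
        simp only [map_sub, Finset.sum_sub_distrib]
        abel
      · obtain ⟨w, hw, hwn⟩ := hκ i n
        change κ i n ∈ Bop i (W i n (v i n - κ i n) - L i (x n - π n) +
          ((2 : ℝ) • L i (a n) - d i n) - t i n - r i + L i (π n))
        have h1 := congrArg (W i n) hwn
        rw [map_sub, map_add, hWQ, hWQ, hydef, hpdef] at h1
        convert hw using 2
        rw [← h1]
        simp only [map_sub, map_add, map_smul]
        module)
  have hsplit : ∀ i, L i ξ.fst - r i = (L i ξ.fst - r i - g.snd i) + g.snd i := fun i => by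
    abel
  have hA : z - ∑ i, (ContinuousLinearMap.adjoint (L i)) (ξ.snd i) - C ξ.fst ∈ A ξ.fst := by
    convert hgM.1 using 1
    rw [WithLp.neg_fst, hgN.1]
    abel
  have hB : ∀ i, ξ.snd i ∈ Bop i (L i ξ.fst - r i - g.snd i) := fun i => by
    convert hgM.2 i using 2
    rw [WithLp.neg_snd, PiLp.neg_apply]
    abel
  have hx : ∀ w : H, Tendsto (fun n => ⟪x n, w⟫) atTop (𝓝 ⟪ξ.fst, w⟫) := fun w => by
    simpa [WithLp.inner_prod_pi] using hweak (WithLp.toLp 2 (w, 0))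
  have hv : ∀ i (w : G i), Tendsto (fun n => ⟪v i n, w⟫) atTop (𝓝 ⟪ξ.snd i, w⟫) := fun i w => by
    have hsingle : ∀ y : ∀ i, G i, ∑ j, ⟪y j, Pi.single i w j⟫ = ⟪y i, w⟫ := fun y => by
      rw [Finset.sum_eq_single i (fun j _ hj => by rw [Pi.single_eq_of_ne hj, inner_zero_right])
        (by simp), Pi.single_eq_same]
    have h := hweak (WithLp.toLp 2 (0, WithLp.toLp 2 (Pi.single i w)))
    simp only [WithLp.inner_prod_pi, WithLp.toLp_fst, WithLp.toLp_snd, inner_zero_right, zero_add,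
      hsingle] at h
    exact h
  have hpair := ((WithLp.prod_continuous_ofLp 2 H (PiLp 2 G)).tendsto g).comp hstrong
  have hCx : Tendsto (fun n => C (x n)) atTop (𝓝 (C ξ.fst)) := by
    rw [← hgN.1]
    exact (continuous_fst.tendsto _).comp hpair
  have htj : ∀ j, Tendsto (t j) atTop (𝓝 (g.snd j)) := fun j =>
    (((continuous_apply j).comp (PiLp.continuous_ofLp 2 G)).tendsto _).comp
      ((continuous_snd.tendsto _).comp hpair)
  refine ⟨ξ.fst, fun i => ξ.snd i, ?_, ?_, hx, hv, fun h => ?_, fun j h => ?_⟩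
  · refine (hPrimal _).2 ⟨_, hA, fun i => ξ.snd i, fun i => ⟨_, _, hB i, hgN.2 i, hsplit i⟩, ?_⟩
    abel
  · exact (hDualSol _).2 ⟨_, hA, fun i => ⟨_, _, hB i, hgN.2 i, hsplit i⟩⟩
  · exact h.2 x (fun n => C (x n)) (fun n => rfl) _ rfl hx hCx
  · exact h.2 (v j) (t j) (ht j) _ (hgN.2 j) (hv j) (htj j)
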